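/- Let u ∈ {0,1}^ℕ contain at least two ones and let 1 < m < m' ≤ 2. Then f_u(m) > f_u(m') and g_u(m) < g_u(m'). -/

import Mathlib

/-- `π_β(u)` for a binary sequence `u = u₁u₂⋯` (indexed from 0). -/
noncomputable def piB (β : ℝ) (u : ℕ → Bool) : ℝ :=
  ∑' k : ℕ, (if u k then (1 : ℝ) else 0) / β ^ (k + 1)

/-- `π_β(u)` for a real digit sequence. -/
noncomputable def piR (β : ℝ) (u : ℕ → ℝ) : ℝ := ∑' k : ℕ, u k / β ^ (k + 1)

/-- A binary sequence viewed as a real digit sequence. -/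
def bR (u : ℕ → Bool) : ℕ → ℝ := fun k => if u k then 1 else 0

/-- `U_β(A)`: sequences with digits in `A` whose `π_β`-value has no other expansion over `A`. -/
def Uset (β : ℝ) (A : Set ℝ) : Set (ℕ → ℝ) :=
  {u | (∀ k, u k ∈ A) ∧ ∀ v : ℕ → ℝ, (∀ k, v k ∈ A) → v ≠ u → piR β v ≠ piR β u}

/-- `𝓛(m) = inf {β > 1 : U_β(m) ∩ {0,1}^ℕ is uncountable}`. -/
noncomputable def Lval (m : ℝ) : ℝ :=
  sInf {β : ℝ | 1 < β ∧ ¬ (Uset β {0, 1, m} ∩ {v | ∃ u : ℕ → Bool, v = bR u}).Countable}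

/-- The shift orbit `O(u)` of an infinite binary word. -/
def orbit (u : ℕ → Bool) : Set (ℕ → Bool) := {v | ∃ k : ℕ, v = fun i => u (i + k)}

/-- Suffixes of `u` preceded by the letter `1`. -/
def orbit1 (u : ℕ → Bool) : Set (ℕ → Bool) :=
  {v | ∃ k : ℕ, u k = true ∧ v = fun i => u (i + k + 1)}

/-- Suffixes of `u` preceded by the letter `0`. -/
def orbit0 (u : ℕ → Bool) : Set (ℕ → Bool) :=
  {v | ∃ k : ℕ, u k = false ∧ v = fun i => u (i + k + 1)}

open Classical in
/-- The lexicographic supremum of a set of binary sequences (greedy construction);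
`⊥ = 0̄` for the empty set. -/
noncomputable def lexSupSeq (S : Set (ℕ → Bool)) : ℕ → Bool
  | n => decide (∃ u ∈ S, (∀ i, i < n → u i = lexSupSeq S i) ∧ u n = true)
  termination_by n => n

open Classical in
/-- The lexicographic infimum of a set of binary sequences (greedy construction);
`⊤ = 1̄` for the empty set. -/
noncomputable def lexInfSeq (S : Set (ℕ → Bool)) : ℕ → Bool
  | n => decide (¬ ∃ u ∈ S, (∀ i, i < n → u i = lexInfSeq S i) ∧ u n = false)
  termination_by n => n

/-- `sup O(u)`, the lexicographically largest limit of suffixes of `u`. -/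
noncomputable def supO (u : ℕ → Bool) : ℕ → Bool := lexSupSeq (orbit u)
/-- `inf O(u)`. -/
noncomputable def infO (u : ℕ → Bool) : ℕ → Bool := lexInfSeq (orbit u)
/-- `sup₀(u)`, the supremum of the suffixes preceded by `0`. -/
noncomputable def sup0 (u : ℕ → Bool) : ℕ → Bool := lexSupSeq (orbit0 u)
/-- `inf₁(u)`, the infimum of the suffixes preceded by `1`. -/
noncomputable def inf1 (u : ℕ → Bool) : ℕ → Bool := lexInfSeq (orbit1 u)

/-- Strict lexicographic order on infinite binary words. -/
def lexLt (u v : ℕ → Bool) : Prop := ∃ n, (∀ i, i < n → u i = v i) ∧ u n < v n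
/-- Lexicographic order on infinite binary words. -/
def lexLe (u v : ℕ → Bool) : Prop := lexLt u v ∨ u = v

/-- `f_u(m)`: the unique `β ≥ 1` with `β·π_β(sup O(u)) = m`. -/
noncomputable def fVal (u : ℕ → Bool) (m : ℝ) : ℝ :=
  sInf {β : ℝ | 1 ≤ β ∧ β * piB β (supO u) = m}

/-- `g_u(m)`: the unique `β > 1` with `(β-1)(1+π_β(inf O(u))) = m`. -/
noncomputable def gVal (u : ℕ → Bool) (m : ℝ) : ℝ :=
  sInf {β : ℝ | 1 < β ∧ (β - 1) * (1 + piB β (infO u)) = m}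

/-- `μ_u`: the unique `m ∈ (1,2]` with `f_u(m) = g_u(m)`. -/
noncomputable def muVal (u : ℕ → Bool) : ℝ :=
  sInf {m : ℝ | 1 < m ∧ m ≤ 2 ∧ fVal u m = gVal u m}

/-- `u` contains at least two ones. -/
def TwoOnes (u : ℕ → Bool) : Prop := ∃ k l, k < l ∧ u k = true ∧ u l = true

/-- The substitution `L : 0 ↦ 0, 1 ↦ 01` (with `0 = false`, `1 = true`). -/
def Lsub : Bool → List Bool := fun b => if b then [false, true] else [false]
/-- The substitution `M : 0 ↦ 01, 1 ↦ 10`. -/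
def Msub : Bool → List Bool := fun b => if b then [true, false] else [false, true]
/-- The substitution `R : 0 ↦ 01, 1 ↦ 1`. -/
def Rsub : Bool → List Bool := fun b => if b then [true] else [false, true]
/-- The identity substitution. -/
def idSub : Bool → List Bool := fun b => [b]
/-- Composition of substitutions: `compSub σ τ = σ ∘ τ` (apply `τ` first). -/
def compSub (σ τ : Bool → List Bool) : Bool → List Bool := fun b => (τ b).flatMap σ

/-- The monoid `{L,M,R}*` generated by the three substitutions. -/
def LMRstar : Set (Bool → List Bool) :=
  {σ | ∃ l : List (Bool → List Bool),
    (∀ τ ∈ l, τ = Lsub ∨ τ = Msub ∨ τ = Rsub) ∧ σ = l.foldr compSub idSub}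

/-- A substitution applied to an infinite word, `σ(u₁)σ(u₂)⋯`. -/
noncomputable def substApply (σ : Bool → List Bool) (u : ℕ → Bool) : ℕ → Bool := fun n =>
  let k := sSup {k : ℕ | (∑ i ∈ Finset.range k, (σ (u i)).length) ≤ n}
  (σ (u k)).getD (n - ∑ i ∈ Finset.range k, (σ (u i)).length) false

/-- `u` is a limit word of the sequence of substitutions `σseq`. -/
def IsLimitWord (σseq : ℕ → Bool → List Bool) (u : ℕ → Bool) : Prop :=
  ∃ useq : ℕ → ℕ → Bool, useq 0 = u ∧ ∀ n, useq n = substApply (σseq n) (useq (n + 1))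

/-- Primitivity of a sequence of substitutions in `{L,M,R}^ℕ`: no tail is constantly `L`
and no tail is constantly `R`. -/
def PrimitiveSeq (σseq : ℕ → Bool → List Bool) : Prop :=
  (¬ ∃ k, ∀ n, k ≤ n → σseq n = Lsub) ∧ ¬ ∃ k, ∀ n, k ≤ n → σseq n = Rsub

/-- `S_{L,M,R}`: the set of limit words of primitive sequences of substitutions. -/
def Sset : Set (ℕ → Bool) :=
  {u | ∃ σseq : ℕ → Bool → List Bool,
    (∀ n, σseq n = Lsub ∨ σseq n = Msub ∨ σseq n = Rsub) ∧
    PrimitiveSeq σseq ∧ IsLimitWord σseq u}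

/-- The word `1 0̄ = 1000⋯`. -/
def w10bar : ℕ → Bool := fun n => decide (n = 0)
/-- The word `0 1̄ = 0111⋯`. -/
def w01bar : ℕ → Bool := fun n => decide (n ≠ 0)
/-- The word `01 0̄ = 01000⋯`. -/
def w010bar : ℕ → Bool := fun n => decide (n = 1)
/-- The word `10 1̄ = 10111⋯`. -/
def w101bar : ℕ → Bool := fun n => decide (n ≠ 1)
/-- The word `0̄`. -/
def w0bar : ℕ → Bool := fun _ => false
/-- The word `1̄`. -/
def w1bar : ℕ → Bool := fun _ => true

/-- Prepend a letter to an infinite word. -/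
def consB (b : Bool) (u : ℕ → Bool) : ℕ → Bool := fun n =>
  match n with
  | 0 => b
  | Nat.succ k => u k

/-- Prepend a finite word to an infinite word. -/
def appendW (w : List Bool) (v : ℕ → Bool) : ℕ → Bool := fun n =>
  if n < w.length then w.getD n false else v (n - w.length)

/-- The power series `∑ w_k x^k` with the letters of a binary word as coefficients. -/
noncomputable def wordSeries (w : ℕ → Bool) (x : ℝ) : ℝ := ∑' k : ℕ, bR w k * x ^ k

lemma bR_nonneg (w : ℕ → Bool) (k : ℕ) : 0 ≤ bR w k := by
  unfold bR; split_ifs <;> norm_num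

lemma bR_le_one (w : ℕ → Bool) (k : ℕ) : bR w k ≤ 1 := by
  unfold bR; split_ifs <;> norm_num

lemma bR_mul_pow_nonneg (w : ℕ → Bool) {x : ℝ} (hx : 0 ≤ x) (k : ℕ) : 0 ≤ bR w k * x ^ k :=
  mul_nonneg (bR_nonneg w k) (pow_nonneg hx k)

lemma bR_mul_pow_mono (w : ℕ → Bool) {x y : ℝ} (hx : 0 ≤ x) (hxy : x ≤ y) (k : ℕ) :
    bR w k * x ^ k ≤ bR w k * y ^ k :=
  mul_le_mul_of_nonneg_left (pow_le_pow_left₀ hx hxy k) (bR_nonneg w k)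

lemma summable_bR_mul_pow (w : ℕ → Bool) {x : ℝ} (hx : 0 ≤ x) (hx1 : x < 1) :
    Summable fun k => bR w k * x ^ k :=
  Summable.of_nonneg_of_le (bR_mul_pow_nonneg w hx)
    (fun k => mul_le_of_le_one_left (pow_nonneg hx k) (bR_le_one w k))
    (summable_geometric_of_lt_one hx hx1)

lemma piB_eq_wordSeries (w : ℕ → Bool) (β : ℝ) : piB β w = β⁻¹ * wordSeries w β⁻¹ := by
  unfold piB wordSeries
  rw [← tsum_mul_left]
  refine tsum_congr fun k => ?_
  rw [bR, div_eq_mul_inv, ← inv_pow, pow_succ]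
  ring

lemma continuousOn_wordSeries (w : ℕ → Bool) {y : ℝ} (hs : Summable fun k => bR w k * y ^ k) :
    ContinuousOn (wordSeries w) (Set.Icc 0 y) := by
  refine continuousOn_tsum (fun k => by fun_prop) hs fun k x hx => ?_
  rw [Real.norm_of_nonneg (bR_mul_pow_nonneg w hx.1 k)]
  exact bR_mul_pow_mono w hx.1 hx.2 k

lemma wordSeries_mono (w : ℕ → Bool) {x y : ℝ} (hx : 0 ≤ x) (hxy : x ≤ y)
    (hs : Summable fun k => bR w k * y ^ k) : wordSeries w x ≤ wordSeries w y :=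
  (hs.of_nonneg_of_le (bR_mul_pow_nonneg w hx) (bR_mul_pow_mono w hx hxy)).tsum_le_tsum
    (bR_mul_pow_mono w hx hxy) hs

lemma wordSeries_zero (w : ℕ → Bool) (h0 : w 0 = true) : wordSeries w 0 = 1 := by
  unfold wordSeries
  rw [tsum_eq_single 0 (fun k hk => by simp [hk])]
  simp [bR, h0]

lemma summable_of_wordSeries_pos (w : ℕ → Bool) {x : ℝ} (h : 0 < wordSeries w x) :
    Summable fun k => bR w k * x ^ k := by
  by_contra hs
  rw [wordSeries, tsum_eq_zero_of_not_summable hs] at h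
  exact lt_irrefl _ h

lemma wordSeries_nonneg (w : ℕ → Bool) {x : ℝ} (hx : 0 ≤ x) : 0 ≤ wordSeries w x :=
  tsum_nonneg (bR_mul_pow_nonneg w hx)

lemma wordSeries_add_not (w : ℕ → Bool) {x : ℝ} (hx : 0 ≤ x) (hx1 : x < 1) :
    wordSeries w x + wordSeries (fun k => !w k) x = (1 - x)⁻¹ := by
  unfold wordSeries
  rw [← (summable_bR_mul_pow w hx hx1).tsum_add (summable_bR_mul_pow _ hx hx1),
    ← tsum_geometric_of_lt_one hx hx1]
  refine tsum_congr fun k => ?_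
  cases h : w k <;> simp [bR, h]

lemma sum_pow_le_wordSeries (w : ℕ → Bool) {x : ℝ} (hx : 0 ≤ x) (t : Finset ℕ)
    (ht : ∀ k ∈ t, w k = true) (hs : Summable fun k => bR w k * x ^ k) :
    ∑ k ∈ t, x ^ k ≤ wordSeries w x := by
  refine le_trans (Finset.sum_le_sum fun k hk => ?_)
    (hs.sum_le_tsum t fun k _ => bR_mul_pow_nonneg w hx k)
  simp [bR, ht k hk]

/-- A word with at least two ones has a power series reaching the value `2` on `(0, 1]`. -/
lemma exists_two_le_wordSeries (w : ℕ → Bool) {n : ℕ} (hn : 0 < n) (h0 : w 0 = true)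
    (h : w n = true) :
    ∃ y : ℝ, 0 < y ∧ y ≤ 1 ∧ (Summable fun k => bR w k * y ^ k) ∧ 2 ≤ wordSeries w y := by
  by_cases hf : {k | w k = true}.Finite
  · have hs : Summable fun k => bR w k * (1 : ℝ) ^ k := by
      refine summable_of_ne_finset_zero (s := hf.toFinset) fun k hk => ?_
      have : ¬ w k = true := by simpa using hk
      simp [bR, this]
    refine ⟨1, one_pos, le_rfl, hs, ?_⟩
    have := sum_pow_le_wordSeries w zero_le_one {0, n} (by simp [h0, h]) hs
    rw [Finset.sum_pair hn.ne] at this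
    norm_num at this
    exact this
  · obtain ⟨t, ht, hc⟩ := Set.Infinite.exists_subset_card_eq hf 3
    have hcont : Filter.Tendsto (fun x : ℝ => ∑ k ∈ t, x ^ k) (nhdsWithin 1 (Set.Iio 1))
        (nhds (∑ k ∈ t, (1 : ℝ) ^ k)) :=
      (Continuous.tendsto (by fun_prop) 1).mono_left nhdsWithin_le_nhds
    have h2 : (2 : ℝ) < ∑ k ∈ t, (1 : ℝ) ^ k := by simp [hc]; norm_num
    obtain ⟨y, hy, hy0, hy1⟩ :=
      ((hcont.eventually (lt_mem_nhds h2)).and (Ioo_mem_nhdsLT (zero_lt_one' ℝ))).exists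
    have hs := summable_bR_mul_pow w hy0.le hy1
    exact ⟨y, hy0, hy1.le, hs,
      hy.le.trans (sum_pow_le_wordSeries w hy0.le t (fun k hk => ht hk) hs)⟩

lemma exists_mul_piB_eq (w : ℕ → Bool) {n : ℕ} (hn : 0 < n) (h0 : w 0 = true) (h : w n = true)
    {m : ℝ} (h1 : 1 < m) (h2 : m ≤ 2) : ∃ β : ℝ, 1 ≤ β ∧ β * piB β w = m := by
  obtain ⟨y, hy0, hy1, hs, hy⟩ := exists_two_le_wordSeries w hn h0 h
  obtain ⟨x, hx, hxm⟩ := intermediate_value_Icc hy0.le (continuousOn_wordSeries w hs)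
    (show m ∈ Set.Icc _ _ from ⟨by rw [wordSeries_zero w h0]; exact h1.le, h2.trans hy⟩)
  have hx0 : 0 < x := by
    refine lt_of_le_of_ne hx.1 ?_
    rintro rfl
    rw [wordSeries_zero w h0] at hxm
    exact h1.ne hxm
  refine ⟨x⁻¹, (one_le_inv₀ hx0).2 (hx.2.trans hy1), ?_⟩
  rw [piB_eq_wordSeries, inv_inv, hxm, inv_mul_cancel_left₀ hx0.ne']

lemma lt_of_mul_piB_lt (w : ℕ → Bool) {m m' β β' : ℝ} (hm : 0 < m)
    (hmm : m < m') (hβ : 1 ≤ β ∧ β * piB β w = m) (hβ' : 1 ≤ β' ∧ β' * piB β' w = m') :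
    β' < β := by
  have key : ∀ b : ℝ, 1 ≤ b → b * piB b w = wordSeries w b⁻¹ := fun b hb => by
    rw [piB_eq_wordSeries, mul_inv_cancel_left₀ (by positivity)]
  by_contra! hle
  have e := hβ.2
  have e' := hβ'.2
  rw [key _ hβ.1] at e
  rw [key _ hβ'.1] at e'
  have hb : 0 < β := one_pos.trans_le hβ.1
  have hb' : 0 < β' := one_pos.trans_le hβ'.1
  have := wordSeries_mono w (inv_nonneg.2 hb'.le) (inv_anti₀ hb hle)
    (summable_of_wordSeries_pos w (by rw [e]; exact hm))
  linarith

/-- Solutions of `β·π_β(w) = m` are unique when `w` has a one beyond its first letter. -/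
lemma mul_piB_injOn (w : ℕ → Bool) {n : ℕ} (hn : 0 < n) (h : w n = true) {m β β' : ℝ}
    (hm : 0 < m) (hβ : 1 ≤ β ∧ β * piB β w = m) (hβ' : 1 ≤ β' ∧ β' * piB β' w = m) :
    β = β' := by
  wlog hlt : β < β' generalizing β β'
  · rcases lt_trichotomy β β' with h' | h' | h'
    · exact this hβ hβ' h'
    · exact h'
    · exact (this hβ' hβ h').symm
  have hb : 0 < β := one_pos.trans_le hβ.1
  have hb' : 0 < β' := one_pos.trans_le hβ'.1
  have e := hβ.2
  have e' := hβ'.2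
  rw [piB_eq_wordSeries, mul_inv_cancel_left₀ hb.ne'] at e
  rw [piB_eq_wordSeries, mul_inv_cancel_left₀ hb'.ne'] at e'
  have hinv : β'⁻¹ < β⁻¹ := inv_strictAnti₀ hb hlt
  have hx : 0 ≤ β'⁻¹ := inv_nonneg.2 hb'.le
  have : wordSeries w β'⁻¹ < wordSeries w β⁻¹ := by
    refine Summable.tsum_lt_tsum (i := n) (bR_mul_pow_mono w hx hinv.le) ?_
      (summable_of_wordSeries_pos w (by rw [e']; exact hm))
      (summable_of_wordSeries_pos w (by rw [e]; exact hm))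
    have : bR w n = 1 := by simp [bR, h]
    rw [this, one_mul, one_mul]
    exact pow_lt_pow_left₀ hinv hx hn.ne'
  linarith

/-- `(β-1)(1+π_β(w)) = 1 + (β-1)(1-π_β(v))` with `v` the complement of `w`. -/
lemma sub_one_mul_one_add_piB (w : ℕ → Bool) {β : ℝ} (hβ : 1 < β) :
    (β - 1) * (1 + piB β w) = 1 + (β - 1) * (1 - piB β fun k => !w k) := by
  have hb : 0 < β := one_pos.trans hβ
  have h := wordSeries_add_not w (inv_nonneg.2 hb.le) (inv_lt_one_of_one_lt₀ hβ)
  have hsum : piB β w + piB β (fun k => !w k) = (β - 1)⁻¹ := by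
    rw [piB_eq_wordSeries, piB_eq_wordSeries, ← mul_add, h, ← mul_inv, mul_sub, mul_one,
      mul_inv_cancel₀ hb.ne']
  have hne : β - 1 ≠ 0 := (sub_pos.2 hβ).ne'
  have := congrArg (fun z => (β - 1) * z) hsum
  simp only [mul_inv_cancel₀ hne] at this
  linarith

lemma piB_nonneg (w : ℕ → Bool) {β : ℝ} (hβ : 1 < β) : 0 ≤ piB β w := by
  rw [piB_eq_wordSeries]
  have hb : 0 ≤ β⁻¹ := inv_nonneg.2 (one_pos.trans hβ).le
  exact mul_nonneg hb (wordSeries_nonneg w hb)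

lemma piB_anti (w : ℕ → Bool) {β β' : ℝ} (hβ : 1 < β) (h : β ≤ β') : piB β' w ≤ piB β w := by
  have hb : 0 < β := one_pos.trans hβ
  have hb' : 0 ≤ β'⁻¹ := inv_nonneg.2 (hb.le.trans h)
  rw [piB_eq_wordSeries, piB_eq_wordSeries]
  exact mul_le_mul (inv_anti₀ hb h)
    (wordSeries_mono w hb' (inv_anti₀ hb h)
      (summable_bR_mul_pow w (inv_nonneg.2 hb.le) (inv_lt_one_of_one_lt₀ hβ)))
    (wordSeries_nonneg w hb') (inv_nonneg.2 hb.le)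

lemma continuousOn_piB (w : ℕ → Bool) {a b : ℝ} (ha : 1 < a) :
    ContinuousOn (fun β => piB β w) (Set.Icc a b) := by
  have hinv : ContinuousOn (fun β : ℝ => β⁻¹) (Set.Icc a b) :=
    continuousOn_inv₀.mono fun x hx => ne_of_gt (by linarith [hx.1])
  simp only [piB_eq_wordSeries]
  refine hinv.mul ((continuousOn_wordSeries w (summable_bR_mul_pow w
    (inv_nonneg.2 (one_pos.trans ha).le) (inv_lt_one_of_one_lt₀ ha))).comp hinv fun x hx => ?_)
  have hx0 : 0 < x := by linarith [hx.1]
  exact ⟨inv_nonneg.2 hx0.le, inv_anti₀ (one_pos.trans ha) hx.1⟩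

lemma exists_sub_one_mul_one_add_piB_eq (w : ℕ → Bool) {m : ℝ} (hm : 1 < m) :
    ∃ β : ℝ, 1 < β ∧ (β - 1) * (1 + piB β w) = m := by
  have hcont : ContinuousOn (fun β => (β - 1) * (1 + piB β w)) (Set.Icc m (m + 1)) :=
    (continuousOn_id.sub continuousOn_const).mul
      (continuousOn_const.add (continuousOn_piB w hm))
  obtain ⟨β, hβ, he⟩ := intermediate_value_Icc (by linarith) hcont
    (show m ∈ Set.Icc _ _ by
      constructor
      · rw [sub_one_mul_one_add_piB w hm]
        nlinarith [piB_nonneg (fun k => !w k) hm]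
      · nlinarith [piB_nonneg w (show 1 < m + 1 by linarith)])
  exact ⟨β, hm.trans_le hβ.1, he⟩

/-- Beyond a point where `(β-1)(1+π_β(w)) > 1`, this function is strictly increasing. -/
lemma sub_one_mul_one_add_piB_lt (w : ℕ → Bool) {β β' : ℝ} (hβ : 1 < β) (h : β < β')
    (hval : 1 < (β - 1) * (1 + piB β w)) :
    (β - 1) * (1 + piB β w) < (β' - 1) * (1 + piB β' w) := by
  rw [sub_one_mul_one_add_piB w hβ] at hval ⊢
  rw [sub_one_mul_one_add_piB w (hβ.trans h)]
  have hpos : 0 < 1 - piB β fun k => !w k :=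
    pos_of_mul_pos_right (by linarith) (sub_pos.2 hβ).le
  have := piB_anti (fun k => !w k) hβ h.le
  nlinarith

lemma lexSupSeq_eq_true_iff (S : Set (ℕ → Bool)) (n : ℕ) :
    lexSupSeq S n = true ↔ ∃ u ∈ S, (∀ i, i < n → u i = lexSupSeq S i) ∧ u n = true := by
  rw [lexSupSeq]
  simp

/-- The lexicographic supremum is an upper bound. -/
lemma lexLe_lexSupSeq {S : Set (ℕ → Bool)} {v : ℕ → Bool} (hv : v ∈ S) :
    lexLe v (lexSupSeq S) := by
  classical
  by_cases h : v = lexSupSeq S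
  · exact Or.inr h
  · left
    have hex : ∃ n, v n ≠ lexSupSeq S n := Function.ne_iff.1 h
    have hagree : ∀ i, i < Nat.find hex → v i = lexSupSeq S i := fun i hi => by
      simpa using Nat.find_min hex hi
    refine ⟨Nat.find hex, hagree, ?_⟩
    have hne := Nat.find_spec hex
    have himp : v (Nat.find hex) = true → lexSupSeq S (Nat.find hex) = true := fun ht =>
      (lexSupSeq_eq_true_iff S _).2 ⟨v, hv, hagree, ht⟩
    cases h1 : v (Nat.find hex) <;> cases h2 : lexSupSeq S (Nat.find hex) <;> simp_all

/-- If `u` has at least two ones, so does `sup O(u)`, and it starts with a one. -/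
lemma supO_twoOnes {u : ℕ → Bool} (hu : TwoOnes u) :
    supO u 0 = true ∧ ∃ n, 0 < n ∧ supO u n = true := by
  obtain ⟨k, l, hkl, hk, hl⟩ := hu
  have hv : (fun i => u (i + k)) ∈ orbit u := ⟨k, rfl⟩
  have h0 : supO u 0 = true :=
    (lexSupSeq_eq_true_iff _ 0).2 ⟨_, hv, fun i hi => absurd hi (Nat.not_lt_zero i), by simpa⟩
  refine ⟨h0, ?_⟩
  rcases lexLe_lexSupSeq hv with ⟨n, -, hn⟩ | he
  · have hn' : u (n + k) = false ∧ supO u n = true := Bool.lt_iff.1 hn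
    refine ⟨n, Nat.pos_of_ne_zero ?_, hn'.2⟩
    rintro rfl
    simp [hk] at hn'
  · refine ⟨l - k, Nat.sub_pos_of_lt hkl, ?_⟩
    have := congrFun he (l - k)
    simp only [Nat.sub_add_cancel hkl.le, hl] at this
    exact this.symm

lemma fVal_eq {u : ℕ → Bool} {n : ℕ} (hn : 0 < n) (h : supO u n = true) {m b : ℝ} (hm : 0 < m)
    (hb : 1 ≤ b ∧ b * piB b (supO u) = m) : fVal u m = b := by
  have : {β : ℝ | 1 ≤ β ∧ β * piB β (supO u) = m} = {b} :=
    Set.eq_singleton_iff_unique_mem.2 ⟨hb, fun c hc => mul_piB_injOn _ hn h hm hc hb⟩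
  rw [fVal, this, csInf_singleton]

lemma gVal_eq {u : ℕ → Bool} {m b : ℝ} (hm : 1 < m)
    (hb : 1 < b ∧ (b - 1) * (1 + piB b (infO u)) = m) : gVal u m = b := by
  have : {β : ℝ | 1 < β ∧ (β - 1) * (1 + piB β (infO u)) = m} = {b} := by
    refine Set.eq_singleton_iff_unique_mem.2 ⟨hb, fun c hc => ?_⟩
    rcases lt_trichotomy c b with hlt | heq | hlt
    · have := sub_one_mul_one_add_piB_lt (infO u) hc.1 hlt (hm.trans_eq hc.2.symm)
      rw [hb.2, hc.2] at this
      exact absurd this (lt_irrefl m)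
    · exact heq
    · have := sub_one_mul_one_add_piB_lt (infO u) hb.1 hlt (hm.trans_eq hb.2.symm)
      rw [hb.2, hc.2] at this
      exact absurd this (lt_irrefl m)
  rw [gVal, this, csInf_singleton]

/-- `f_u` is strictly decreasing and `g_u` is strictly increasing in `m`. -/
theorem f_decreasing_g_increasing (u : ℕ → Bool) (hu : TwoOnes u) (m m' : ℝ)
    (h1 : 1 < m) (hmm : m < m') (h2 : m' ≤ 2) :
    fVal u m' < fVal u m ∧ gVal u m < gVal u m' := by
  constructor
  · obtain ⟨h0, n, hn, hw⟩ := supO_twoOnes hu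
    obtain ⟨b, hb⟩ := exists_mul_piB_eq (supO u) hn h0 hw h1 (hmm.le.trans h2)
    obtain ⟨b', hb'⟩ := exists_mul_piB_eq (supO u) hn h0 hw (h1.trans hmm) h2
    rw [fVal_eq hn hw (one_pos.trans h1) hb, fVal_eq hn hw (one_pos.trans (h1.trans hmm)) hb']
    exact lt_of_mul_piB_lt (supO u) (one_pos.trans h1) hmm hb hb'
  · obtain ⟨b, hb⟩ := exists_sub_one_mul_one_add_piB_eq (infO u) h1
    obtain ⟨b', hb'⟩ := exists_sub_one_mul_one_add_piB_eq (infO u) (h1.trans hmm)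
    rw [gVal_eq h1 hb, gVal_eq (h1.trans hmm) hb']
    by_contra! hle
    rcases hle.lt_or_eq with hlt | rfl
    · have := sub_one_mul_one_add_piB_lt (infO u) hb'.1 hlt (by rw [hb'.2]; linarith)
      rw [hb.2, hb'.2] at this
      linarith
    · linarith [hb.2, hb'.2]
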